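/- Let A be a real symmetric positive-definite N×N matrix with nonpositive off-diagonal entries (a symmetric non-singular M-matrix) with connectivity at most W_c for some W_c ≥ 2, and let u := A^{−1}1 be the landscape function, where 1 is the all-ones vector. Then all entries of u are positive, and for every ℓ²-normalized eigenvector φ of A with eigenvalue E one has Σ_{k∈[N]} φ_k² e^{2ρ(k,K_E)/√W_c} (1/u_k − E)_+ ≤ W_c · max_{i,j∈[N]} |a_{ij}|, where ρ = ρ_{A,u,E} and K_E = {k ∈ [N] : 1/u_k ≤ E} (note (Au)_k/u_k = 1/u_k since Au = 1). -/

import Mathlib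

open scoped ENNReal BigOperators
open Matrix

/-- The effective potential `(Au)_i / u_i`. -/
noncomputable def effV {N : ℕ} (A : Matrix (Fin N) (Fin N) ℝ) (u : Fin N → ℝ) (i : Fin N) : ℝ :=
  A.mulVec u i / u i

/-- The shifted effective potential `v_i = ((Au)_i/u_i - E)_+`. -/
noncomputable def shiftedV {N : ℕ} (A : Matrix (Fin N) (Fin N) ℝ) (u : Fin N → ℝ) (E : ℝ)
    (i : Fin N) : ℝ :=
  max (effV A u i - E) 0

/-- The weight of an edge `(i,j)`: `ln(1 + √(√(v_i v_j)/|a_ij|))`. -/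
noncomputable def edgeW {N : ℕ} (A : Matrix (Fin N) (Fin N) ℝ) (u : Fin N → ℝ) (E : ℝ)
    (i j : Fin N) : ℝ≥0∞ :=
  ENNReal.ofReal
    (Real.log (1 + Real.sqrt (Real.sqrt (shiftedV A u E i * shiftedV A u E j) / |A i j|)))

/-- The Agmon-type distance `ρ_{A,u,E}(i,j)`: infimum over paths `i = i_0, …, i_L = j` with
`a_{i_ℓ i_{ℓ+1}} ≠ 0` of the total edge weight; `∞` if there is no such path. -/
noncomputable def agmonDist {N : ℕ} (A : Matrix (Fin N) (Fin N) ℝ) (u : Fin N → ℝ) (E : ℝ)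
    (i j : Fin N) : ℝ≥0∞ :=
  ⨅ (L : ℕ) (p : Fin (L + 1) → Fin N) (_ : p 0 = i) (_ : p (Fin.last L) = j)
    (_ : ∀ ℓ : Fin L, A (p ℓ.castSucc) (p ℓ.succ) ≠ 0),
    ∑ ℓ : Fin L, edgeW A u E (p ℓ.castSucc) (p ℓ.succ)

/-- `ρ(i, M) = inf_{j ∈ M} ρ(i,j)` (`∞` when `M = ∅`). -/
noncomputable def agmonDistToSet {N : ℕ} (A : Matrix (Fin N) (Fin N) ℝ) (u : Fin N → ℝ) (E : ℝ)
    (i : Fin N) (M : Finset (Fin N)) : ℝ≥0∞ :=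
  ⨅ j ∈ M, agmonDist A u E i j

/-- The well set `K_E = {i : v_i = 0} = {i : (Au)_i/u_i ≤ E}`. -/
noncomputable def wellSet {N : ℕ} (A : Matrix (Fin N) (Fin N) ℝ) (u : Fin N → ℝ) (E : ℝ) :
    Finset (Fin N) :=
  Finset.univ.filter fun i => effV A u i ≤ E

/-- A `Z`-matrix: nonpositive off-diagonal entries. -/
def IsZMatrix {N : ℕ} (A : Matrix (Fin N) (Fin N) ℝ) : Prop :=
  ∀ i j, i ≠ j → A i j ≤ 0

/-- Connectivity at most `W`: every row and column has at most `W` nonzero off-diagonal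
entries. -/
def ConnAtMost {N : ℕ} (A : Matrix (Fin N) (Fin N) ℝ) (W : ℕ) : Prop :=
  ∀ i : Fin N, (Finset.univ.filter fun j => j ≠ i ∧ A i j ≠ 0).card ≤ W ∧
    (Finset.univ.filter fun j => j ≠ i ∧ A j i ≠ 0).card ≤ W

/-- `φ` is a local eigenvector of `A` on `M` with eigenvalue `E`: `φ ≠ 0`, `I_M φ = φ`, and
`I_M A I_M φ = E φ`. -/
def IsLocalEigenvector {N : ℕ} (A : Matrix (Fin N) (Fin N) ℝ) (M : Finset (Fin N)) (E : ℝ)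
    (φ : Fin N → ℝ) : Prop :=
  φ ≠ 0 ∧ (∀ i, i ∉ M → φ i = 0) ∧ (∀ i, i ∈ M → A.mulVec φ i = E * φ i)

/-- Extended exponential `e^x` for `x ∈ [0,∞]`. -/
noncomputable def eexp (x : ℝ≥0∞) : ℝ≥0∞ :=
  if x = ⊤ then ⊤ else ENNReal.ofReal (Real.exp x.toReal)

/-- Symmetrization of a double sum. -/
lemma sum_sum_eq_half_symm {ι : Type*} [Fintype ι] (F : ι → ι → ℝ) :
    ∑ i, ∑ j, F i j = (1 / 2) * ∑ i, ∑ j, (F i j + F j i) := by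
  have h : ∑ i, ∑ j, F j i = ∑ i, ∑ j, F i j := Finset.sum_comm
  simp only [Finset.sum_add_distrib]
  rw [h]
  ring

/-- Monotonicity of symmetric positive-definite `Z`-matrices, in the strict form needed for the
landscape function. -/
lemma pos_of_mulVec_eq_one {N : ℕ} {A : Matrix (Fin N) (Fin N) ℝ} (hpos : A.PosDef)
    (hZ : IsZMatrix A) {u : Fin N → ℝ} (hu : A.mulVec u = 1) (k : Fin N) : 0 < u k := by
  have hrow : ∀ i, ∑ j, A i j * u j = 1 := fun i => by
    simpa [Matrix.mulVec, dotProduct] using congrFun hu i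
  have hneg : (fun i => max (-u i) 0) = (0 : Fin N → ℝ) := by
    by_contra hne
    have h := hpos.dotProduct_mulVec_pos hne
    simp only [star_trivial, dotProduct, Matrix.mulVec] at h
    have hle : ∑ i, max (-u i) 0 * ∑ j, A i j * max (-u j) 0 ≤ 0 := by
      have h1 : ∀ i, max (-u i) 0 * ∑ j, A i j * max (-u j) 0
          ≤ max (-u i) 0 * -∑ j, A i j * u j := by
        intro i
        rw [← Finset.sum_neg_distrib, Finset.mul_sum, Finset.mul_sum]
        refine Finset.sum_le_sum fun j _ => ?_
        by_cases hij : i = j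
        · subst hij
          rcases le_total (u i) 0 with h0 | h0
          · rw [max_eq_left (by linarith)]; linarith
          · rw [max_eq_right (by linarith)]; simp
        · have h2 := hZ i j hij
          have h3 : (0 : ℝ) ≤ max (-u i) 0 := le_max_right _ _
          have h4 : -u j ≤ max (-u j) 0 := le_max_left _ _
          have h5 := mul_le_mul_of_nonpos_left h4 h2
          exact mul_le_mul_of_nonneg_left (by linarith) h3
      refine Finset.sum_nonpos fun i _ => (h1 i).trans ?_
      rw [hrow i]
      have h3 : (0 : ℝ) ≤ max (-u i) 0 := le_max_right _ _
      linarith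
    linarith
  have hnn : ∀ i, 0 ≤ u i := fun i => by
    have h1 : max (-u i) 0 = 0 := congrFun hneg i
    have h2 : -u i ≤ max (-u i) 0 := le_max_left _ _
    linarith
  refine lt_of_le_of_ne (hnn k) fun h0 => ?_
  have hle : ∑ j, A k j * u j ≤ 0 := by
    refine Finset.sum_nonpos fun j _ => ?_
    by_cases hkj : k = j
    · subst hkj
      simp [← h0]
    · exact mul_nonpos_of_nonpos_of_nonneg (hZ k j hkj) (hnn j)
  linarith [hrow k]

/-- The landscape uncertainty principle: the effective potential `1 / u` is dominated by `A` as a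
quadratic form. -/
lemma sum_div_landscape_le {N : ℕ} {A : Matrix (Fin N) (Fin N) ℝ} (hA : A.IsSymm)
    (hZ : IsZMatrix A) {u : Fin N → ℝ} (hu : A.mulVec u = 1) (hu0 : ∀ k, 0 < u k)
    (f : Fin N → ℝ) :
    ∑ i, 1 / u i * f i ^ 2 ≤ ∑ i, ∑ j, A i j * (f i * f j) := by
  have hrow : ∀ i, ∑ j, A i j * u j = 1 := fun i => by
    simpa [Matrix.mulVec, dotProduct] using congrFun hu i
  have h1 : ∑ i, 1 / u i * f i ^ 2 = ∑ i, ∑ j, A i j * u j * (f i ^ 2 / u i) := by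
    refine Finset.sum_congr rfl fun i _ => ?_
    rw [← Finset.sum_mul, hrow i]
    ring
  rw [h1, sum_sum_eq_half_symm, Finset.mul_sum]
  refine Finset.sum_le_sum fun i _ => ?_
  rw [Finset.mul_sum]
  refine Finset.sum_le_sum fun j _ => ?_
  rw [hA.apply i j]
  have hi := hu0 i
  have hj := hu0 j
  by_cases hij : i = j
  · subst hij
    field_simp
    linarith
  · have key : 2 * (f i * f j) ≤ u j * (f i ^ 2 / u i) + u i * (f j ^ 2 / u j) := by
      have : u j * (f i ^ 2 / u i) + u i * (f j ^ 2 / u j) - 2 * (f i * f j)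
          = (u j * f i - u i * f j) ^ 2 / (u i * u j) := by
        field_simp
        ring
      have h0 : 0 ≤ (u j * f i - u i * f j) ^ 2 / (u i * u j) := by positivity
      linarith
    have := mul_le_mul_of_nonpos_left key (hZ i j hij)
    linarith

/-- Conjugating an eigenvector by a multiplication operator. -/
lemma sum_conj_eigenvector {N : ℕ} {A : Matrix (Fin N) (Fin N) ℝ} (hA : A.IsSymm)
    {φ : Fin N → ℝ} {E : ℝ} (hφ : A.mulVec φ = E • φ) (g : Fin N → ℝ) :
    ∑ i, ∑ j, A i j * (g i * φ i * (g j * φ j))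
      = ∑ i, E * (g i * φ i) ^ 2
        + (1 / 2) * ∑ i, ∑ j, -A i j * (g i - g j) ^ 2 * (φ i * φ j) := by
  have hrow : ∀ i, ∑ j, A i j * φ j = E * φ i := fun i => by
    simpa [Matrix.mulVec, dotProduct] using congrFun hφ i
  have h1 : ∑ i, E * (g i * φ i) ^ 2 = ∑ i, ∑ j, A i j * φ j * (g i ^ 2 * φ i) := by
    refine Finset.sum_congr rfl fun i _ => ?_
    rw [← Finset.sum_mul, hrow i]
    ring
  rw [h1, sum_sum_eq_half_symm (fun i j => A i j * φ j * (g i ^ 2 * φ i)), ← mul_add,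
    sum_sum_eq_half_symm]
  congr 1
  simp only [← Finset.sum_add_distrib]
  refine Finset.sum_congr rfl fun i _ => Finset.sum_congr rfl fun j _ => ?_
  rw [hA.apply i j]
  ring

/-- Agmon estimate for an arbitrary weight `g` that is slowly varying relative to the shifted
effective potential and equals one on the well. -/
lemma agmon_weighted_sum_le {N : ℕ} {A : Matrix (Fin N) (Fin N) ℝ} (hA : A.IsSymm)
    (hZ : IsZMatrix A) {W : ℕ} (hW : 0 < W) (hconn : ConnAtMost A W)
    {u : Fin N → ℝ} (hu : A.mulVec u = 1) (hu0 : ∀ k, 0 < u k)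
    {φ : Fin N → ℝ} {E : ℝ} (hnorm : ∑ k, φ k ^ 2 = 1) (hφ : A.mulVec φ = E • φ)
    {B : ℝ} (hB0 : 0 ≤ B) (hB : ∀ i, E - 1 / u i ≤ B)
    {g : Fin N → ℝ} (hgK : ∀ i, 1 / u i ≤ E → g i = 1)
    (hg : ∀ i j, A i j ≠ 0 → |A i j| * (g i - g j) ^ 2 ≤
      g i * g j * √(max (1 / u i - E) 0 * max (1 / u j - E) 0) / W) :
    ∑ k, φ k ^ 2 * g k ^ 2 * max (1 / u k - E) 0 ≤ 2 * B := by
  classical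
  set v : Fin N → ℝ := fun i => max (1 / u i - E) 0 with hv
  have hv0 : ∀ i, 0 ≤ v i := fun i => le_max_right _ _
  set x : Fin N → ℝ := fun i => φ i ^ 2 * g i ^ 2 * v i with hx
  have hx0 : ∀ i, 0 ≤ x i := fun i => by
    have := hv0 i
    positivity
  have hWpos : (0 : ℝ) < W := by exact_mod_cast hW
  have hmain := sum_div_landscape_le hA hZ hu hu0 (fun i => g i * φ i)
  rw [sum_conj_eigenvector hA hφ g] at hmain
  have hsplit : ∑ k, x k ≤ ∑ i, 1 / u i * (g i * φ i) ^ 2 - ∑ i, E * (g i * φ i) ^ 2 + B := by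
    have hBsum : B = ∑ i, B * φ i ^ 2 := by rw [← Finset.mul_sum, hnorm, mul_one]
    rw [hBsum, ← Finset.sum_sub_distrib, ← Finset.sum_add_distrib]
    refine Finset.sum_le_sum fun i _ => ?_
    simp only [hx, hv]
    rcases le_or_gt (1 / u i) E with h | h
    · rw [max_eq_right (by linarith), hgK i h]
      have := mul_le_mul_of_nonneg_right (hB i) (sq_nonneg (φ i))
      nlinarith
    · rw [max_eq_left (by linarith)]
      have : 0 ≤ B * φ i ^ 2 := by positivity
      nlinarith
  have hterm : ∀ i j, -A i j * (g i - g j) ^ 2 * (φ i * φ j)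
      ≤ if j ≠ i ∧ A i j ≠ 0 then 1 / (2 * W) * (x i + x j) else 0 := by
    intro i j
    split_ifs with h
    · have h1 := hg i j h.2
      have h2 : -A i j = |A i j| := (abs_of_nonpos (hZ i j (Ne.symm h.1))).symm
      have h3 : -A i j * (g i - g j) ^ 2 * (φ i * φ j)
          ≤ |A i j| * (g i - g j) ^ 2 * |φ i * φ j| := by
        rw [h2]
        exact mul_le_mul_of_nonneg_left (le_abs_self _) (by positivity)
      have h4 := mul_le_mul_of_nonneg_right h1 (abs_nonneg (φ i * φ j))
      refine h3.trans (h4.trans ?_)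
      rw [Real.sqrt_mul (hv0 i), abs_mul]
      have h5 := two_mul_le_add_sq (g i * |φ i| * √(v i)) (g j * |φ j| * √(v j))
      have h6 : ∀ k, (g k * |φ k| * √(v k)) ^ 2 = x k := fun k => by
        rw [mul_pow, mul_pow, sq_abs, Real.sq_sqrt (hv0 k)]
        ring
      rw [h6, h6] at h5
      have h7 := mul_le_mul_of_nonneg_left h5 (by positivity : (0 : ℝ) ≤ 1 / (2 * W))
      refine le_trans (le_of_eq ?_) h7
      simp only [hv]
      field_simp
    · rcases not_and_or.mp h with h | h
      · have : j = i := not_not.mp h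
        simp [this]
      · have : A i j = 0 := not_not.mp h
        simp [this]
  have hcount : ∑ i, ∑ j, (if j ≠ i ∧ A i j ≠ 0 then 1 / (2 * W) * (x i + x j) else 0)
      ≤ ∑ i, x i := by
    have hsum : ∑ i, ∑ j, (if j ≠ i ∧ A i j ≠ 0 then 1 / (2 * W) * (x i + x j) else 0)
        = ∑ i, ∑ j, (if j ≠ i ∧ A i j ≠ 0 then 1 / W * x i else 0) := by
      rw [sum_sum_eq_half_symm (fun i j => if j ≠ i ∧ A i j ≠ 0 then 1 / W * x i else 0),
        Finset.mul_sum]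
      refine Finset.sum_congr rfl fun i _ => ?_
      rw [Finset.mul_sum]
      refine Finset.sum_congr rfl fun j _ => ?_
      simp only [hA.apply i j, ne_comm (a := i)]
      split_ifs
      · field_simp
      · simp
    rw [hsum]
    refine Finset.sum_le_sum fun i _ => ?_
    rw [← Finset.sum_filter, Finset.sum_const, nsmul_eq_mul]
    have hc : ((Finset.univ.filter fun j => j ≠ i ∧ A i j ≠ 0).card : ℝ) ≤ W := by
      exact_mod_cast (hconn i).1
    have := mul_le_mul_of_nonneg_right hc (mul_nonneg (by positivity : (0 : ℝ) ≤ 1 / W) (hx0 i))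
    refine this.trans (le_of_eq ?_)
    field_simp
  have hsumle := (Finset.sum_le_sum fun i (_ : i ∈ Finset.univ) =>
    Finset.sum_le_sum fun j (_ : j ∈ Finset.univ) => hterm i j).trans hcount
  change ∑ k, x k ≤ 2 * B
  linarith

lemma agmonDistToSet_eq_zero {N : ℕ} (A : Matrix (Fin N) (Fin N) ℝ) (u : Fin N → ℝ) (E : ℝ)
    {i : Fin N} {M : Finset (Fin N)} (hi : i ∈ M) : agmonDistToSet A u E i M = 0 := by
  refine le_antisymm ((iInf₂_le i hi).trans ?_) zero_le
  refine (iInf_le _ 0).trans ((iInf_le _ fun _ => i).trans ?_)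
  simp

lemma agmonDist_le_edgeW_add {N : ℕ} (A : Matrix (Fin N) (Fin N) ℝ) (u : Fin N → ℝ) (E : ℝ)
    {i j : Fin N} (hij : A i j ≠ 0) (k : Fin N) :
    agmonDist A u E i k ≤ edgeW A u E i j + agmonDist A u E j k := by
  conv_rhs => rw [agmonDist]
  simp only [ENNReal.add_iInf]
  refine le_iInf fun L => le_iInf fun p => le_iInf fun h0 => le_iInf fun hL => le_iInf fun hp => ?_
  refine (iInf_le _ (L + 1)).trans ((iInf_le _ (Fin.cons i p : Fin (L + 2) → Fin N)).trans ?_)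
  refine (iInf_le _ rfl).trans ((iInf_le _ ?_).trans ((iInf_le _ ?_).trans ?_))
  · rw [← Fin.succ_last, Fin.cons_succ, hL]
  · intro l
    refine Fin.cases ?_ (fun l => ?_) l
    · simpa [h0] using hij
    · rw [← Fin.succ_castSucc, Fin.cons_succ, Fin.cons_succ]
      exact hp l
  · rw [Fin.sum_univ_succ]
    simp only [← Fin.succ_castSucc, Fin.cons_succ, Fin.castSucc_zero, Fin.cons_zero, h0, le_refl]

lemma agmonDistToSet_le_edgeW_add {N : ℕ} (A : Matrix (Fin N) (Fin N) ℝ) (u : Fin N → ℝ) (E : ℝ)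
    {i j : Fin N} (hij : A i j ≠ 0) (M : Finset (Fin N)) :
    agmonDistToSet A u E i M ≤ edgeW A u E i j + agmonDistToSet A u E j M := by
  conv_rhs => rw [agmonDistToSet]
  simp only [ENNReal.add_iInf]
  exact le_iInf₂ fun k hk => (iInf₂_le k hk).trans (agmonDist_le_edgeW_add A u E hij k)

lemma exp_mul_le_of_le_log_add {α s a b : ℝ} (hα0 : 0 ≤ α) (hα1 : α ≤ 1) (hs : 0 ≤ s)
    (h : a ≤ Real.log (1 + s) + b) :
    Real.exp (α * a) ≤ (1 + α * s) * Real.exp (α * b) := by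
  have h1 : Real.exp (α * a) ≤ Real.exp (Real.log (1 + s) * α) * Real.exp (α * b) := by
    rw [← Real.exp_add, Real.exp_le_exp]
    nlinarith
  rw [← Real.rpow_def_of_pos (by linarith)] at h1
  refine h1.trans (mul_le_mul_of_nonneg_right ?_ (Real.exp_pos _).le)
  exact rpow_one_add_le_one_add_mul_self (by linarith) hα0 hα1

lemma sq_sub_le_of_le_one_add_mul {x y t : ℝ} (hx : 0 ≤ x) (hy : 0 ≤ y)
    (hxy : x ≤ (1 + t) * y) (hyx : y ≤ (1 + t) * x) : (x - y) ^ 2 ≤ x * y * t ^ 2 := by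
  rcases le_total x y with h | h
  · have h1 : (x - y) ^ 2 ≤ (t * x) ^ 2 := sq_le_sq' (by linarith) (by nlinarith)
    have h2 : x * x * t ^ 2 ≤ x * y * t ^ 2 := by gcongr
    linarith
  · have h1 : (x - y) ^ 2 ≤ (t * y) ^ 2 := sq_le_sq' (by nlinarith) (by linarith)
    have h2 : y * y * t ^ 2 ≤ x * y * t ^ 2 := by gcongr
    linarith

/-- The exponential weight `e^{ρ/√W}`, with the value `c` at infinite distance. -/
noncomputable def agmonWeight (W : ℕ) (c : ℝ) (r : ℝ≥0∞) : ℝ :=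
  if r = ⊤ then c else Real.exp (1 / √(W : ℝ) * r.toReal)

lemma agmonWeight_slowly_varying {W : ℕ} (hW : 0 < W) (c : ℝ) {a q : ℝ} (ha : 0 < a)
    (hq : 0 ≤ q) {r s : ℝ≥0∞} (hrs : r ≤ ENNReal.ofReal (Real.log (1 + √(q / a))) + s)
    (hsr : s ≤ ENNReal.ofReal (Real.log (1 + √(q / a))) + r) :
    a * (agmonWeight W c r - agmonWeight W c s) ^ 2 ≤
      agmonWeight W c r * agmonWeight W c s * q / W := by
  have hW1 : (1 : ℝ) ≤ W := by exact_mod_cast hW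
  by_cases hr : r = ⊤
  · have hs : s = ⊤ := by
      by_contra hs
      rw [hr, top_le_iff] at hrs
      exact ENNReal.add_ne_top.mpr ⟨ENNReal.ofReal_ne_top, hs⟩ hrs
    simp only [agmonWeight, hr, hs, if_true, sub_self]
    have : 0 ≤ c * c := mul_self_nonneg c
    have : 0 ≤ c * c * q / W := by positivity
    simpa using this
  · have hs : s ≠ ⊤ := fun hs => by
      rw [hs, top_le_iff] at hsr
      exact ENNReal.add_ne_top.mpr ⟨ENNReal.ofReal_ne_top, hr⟩ hsr
    have hlog : 0 ≤ Real.log (1 + √(q / a)) :=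
      Real.log_nonneg (by linarith [Real.sqrt_nonneg (q / a)])
    have toReal_le : ∀ {x y : ℝ≥0∞}, y ≠ ⊤ → x ≤ ENNReal.ofReal (Real.log (1 + √(q / a))) + y →
        x.toReal ≤ Real.log (1 + √(q / a)) + y.toReal := fun {x y} hy h => by
      have := ENNReal.toReal_mono (ENNReal.add_ne_top.mpr ⟨ENNReal.ofReal_ne_top, hy⟩) h
      rwa [ENNReal.toReal_add ENNReal.ofReal_ne_top hy, ENNReal.toReal_ofReal hlog] at this
    have hα0 : 0 ≤ 1 / √(W : ℝ) := by positivity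
    have hα1 : 1 / √(W : ℝ) ≤ 1 := by
      rw [div_le_one (by positivity)]
      exact Real.one_le_sqrt.mpr hW1
    have h1 := exp_mul_le_of_le_log_add hα0 hα1 (Real.sqrt_nonneg _) (toReal_le hs hrs)
    have h2 := exp_mul_le_of_le_log_add hα0 hα1 (Real.sqrt_nonneg _) (toReal_le hr hsr)
    have h3 := sq_sub_le_of_le_one_add_mul (Real.exp_pos _).le (Real.exp_pos _).le h1 h2
    simp only [agmonWeight, if_neg hr, if_neg hs]
    refine (mul_le_mul_of_nonneg_left h3 ha.le).trans (le_of_eq ?_)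
    rw [mul_pow, div_pow, Real.sq_sqrt (by positivity), Real.sq_sqrt (by positivity)]
    field_simp

lemma eexp_eq_agmonWeight_sq (W : ℕ) (c : ℝ) {r : ℝ≥0∞} (hr : r ≠ ⊤) :
    eexp (ENNReal.ofReal (2 / √(W : ℝ)) * r) = ENNReal.ofReal (agmonWeight W c r ^ 2) := by
  rw [eexp, if_neg (ENNReal.mul_ne_top ENNReal.ofReal_ne_top hr), agmonWeight, if_neg hr,
    ENNReal.toReal_mul, ENNReal.toReal_ofReal (by positivity), ← Real.exp_nat_mul]
  congr 2
  push_cast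
  ring

lemma one_div_landscape_le_diag {N : ℕ} {A : Matrix (Fin N) (Fin N) ℝ} (hZ : IsZMatrix A)
    {u : Fin N → ℝ} (hu : A.mulVec u = 1) (hu0 : ∀ k, 0 < u k) (k : Fin N) :
    1 / u k ≤ A k k := by
  have hrow : ∑ j, A k j * u j = 1 := by
    simpa [Matrix.mulVec, dotProduct] using congrFun hu k
  rw [div_le_iff₀ (hu0 k), ← hrow, ← Finset.add_sum_erase _ _ (Finset.mem_univ k)]
  have : ∑ j ∈ Finset.univ.erase k, A k j * u j ≤ 0 := Finset.sum_nonpos fun j hj =>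
    mul_nonpos_of_nonpos_of_nonneg (hZ k j (Finset.ne_of_mem_erase hj).symm) (hu0 j).le
  linarith

/-- Agmon estimate in terms of the landscape function, for the weight with value `c` at infinite
distance from the well. -/
lemma landscape_agmonWeight_sum_le {N : ℕ} {A : Matrix (Fin N) (Fin N) ℝ} (hA : A.IsSymm)
    (hZ : IsZMatrix A) {W : ℕ} (hW : 0 < W) (hconn : ConnAtMost A W)
    {u : Fin N → ℝ} (hu : A.mulVec u = 1) (hu0 : ∀ k, 0 < u k)
    {φ : Fin N → ℝ} {E : ℝ} (hnorm : ∑ k, φ k ^ 2 = 1) (hφ : A.mulVec φ = E • φ)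
    {k₀ : Fin N} (hk₀ : E < 1 / u k₀) (c : ℝ) :
    ∑ k, φ k ^ 2 * agmonWeight W c (agmonDistToSet A u E k
        (Finset.univ.filter fun i => 1 / u i ≤ E)) ^ 2 * max (1 / u k - E) 0
      ≤ 2 * A k₀ k₀ := by
  have hdiag := one_div_landscape_le_diag hZ hu hu0 k₀
  have hinv : ∀ k, 0 < 1 / u k := fun k => one_div_pos.mpr (hu0 k)
  have hV : ∀ i, shiftedV A u E i = max (1 / u i - E) 0 := fun i => by
    rw [shiftedV, effV, hu, Pi.one_apply]
  refine agmon_weighted_sum_le hA hZ hW hconn hu hu0 hnorm hφ ((hinv k₀).le.trans hdiag)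
    (fun i => by linarith [hinv i]) (fun i hi => ?_)
    fun i j hij => ?_
  · rw [agmonDistToSet_eq_zero A u E (by simpa using hi)]
    simp [agmonWeight]
  · have h1 := agmonDistToSet_le_edgeW_add A u E hij (Finset.univ.filter fun i => 1 / u i ≤ E)
    have hji : A j i ≠ 0 := by rwa [hA.apply i j]
    have h2 := agmonDistToSet_le_edgeW_add A u E hji (Finset.univ.filter fun i => 1 / u i ≤ E)
    rw [edgeW, hV, hV] at h1 h2
    rw [hA.apply i j, mul_comm (max (1 / u j - E) 0)] at h2
    exact agmonWeight_slowly_varying hW c (abs_pos.mpr hij) (Real.sqrt_nonneg _) h1 h2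

/-- Exponential localization via the landscape function: Let `A` be a symmetric
positive-definite `N×N` matrix with nonpositive off-diagonal entries (a symmetric non-singular
`M`-matrix) with connectivity at most `W_c ≥ 2`, and let `u := A⁻¹1` be the landscape function.
Then all entries of `u` are positive, and for every `ℓ²`-normalized eigenvector `φ` of `A` with
eigenvalue `E`,
`∑_k φ_k² e^{2ρ(k,K_E)/√W_c} (1/u_k − E)_+ ≤ W_c · max_{i,j} |a_{ij}|`,
where `ρ = ρ_{A,u,E}` and `K_E = {k : 1/u_k ≤ E}`. -/
theorem landscape_localization {N : ℕ} (A : Matrix (Fin N) (Fin N) ℝ)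
    (hA : A.IsSymm) (hpos : A.PosDef) (hZ : IsZMatrix A)
    (Wc : ℕ) (hWc : 2 ≤ Wc) (hconn : ConnAtMost A Wc) :
    (∀ k, 0 < A⁻¹.mulVec 1 k) ∧
      ∀ (φ : Fin N → ℝ) (E : ℝ), (∑ k : Fin N, φ k ^ 2 = 1) → A.mulVec φ = E • φ →
        ∑ k : Fin N, ENNReal.ofReal (φ k ^ 2) *
            eexp (ENNReal.ofReal (2 / Real.sqrt Wc) *
              agmonDistToSet A (A⁻¹.mulVec 1) E k
                (Finset.univ.filter fun i => 1 / A⁻¹.mulVec 1 i ≤ E)) *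
            ENNReal.ofReal (max (1 / A⁻¹.mulVec 1 k - E) 0)
          ≤ ENNReal.ofReal (Wc : ℝ) * ⨆ i : Fin N, ⨆ j : Fin N, ENNReal.ofReal |A i j| := by
  classical
  have hdet : IsUnit A.det := hpos.det_pos.ne'.isUnit
  have hu : A.mulVec (A⁻¹.mulVec 1) = 1 := by
    rw [Matrix.mulVec_mulVec, Matrix.mul_nonsing_inv _ hdet, Matrix.one_mulVec]
  have hu0 : ∀ k, 0 < A⁻¹.mulVec 1 k := pos_of_mulVec_eq_one hpos hZ hu
  refine ⟨hu0, fun φ E hnorm hφ => ?_⟩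
  generalize A⁻¹.mulVec 1 = u at hu hu0 ⊢
  have hW : 0 < Wc := by omega
  by_cases hex : ∃ k₀, E < 1 / u k₀
  swap
  · push Not at hex
    refine le_of_eq_of_le (Finset.sum_eq_zero fun k _ => ?_) zero_le
    rw [max_eq_right (by linarith [hex k])]
    simp
  obtain ⟨k₀, hk₀⟩ := hex
  set ρ : Fin N → ℝ≥0∞ := fun k =>
    agmonDistToSet A u E k (Finset.univ.filter fun i => 1 / u i ≤ E) with hρ
  have hbound : ∀ c : ℝ,
      ∑ k, φ k ^ 2 * agmonWeight Wc c (ρ k) ^ 2 * max (1 / u k - E) 0 ≤ 2 * A k₀ k₀ :=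
    fun c => landscape_agmonWeight_sum_le hA hZ hW hconn hu hu0 hnorm hφ hk₀ c
  have hdiag : 0 < A k₀ k₀ :=
    (one_div_pos.mpr (hu0 k₀)).trans_le (one_div_landscape_le_diag hZ hu hu0 k₀)
  have hnn : ∀ (c : ℝ) (k : Fin N),
      0 ≤ φ k ^ 2 * agmonWeight Wc c (ρ k) ^ 2 * max (1 / u k - E) 0 := fun c k =>
    mul_nonneg (by positivity) (le_max_right _ _)
  have htop : ∀ k, ρ k = ⊤ → φ k ^ 2 * max (1 / u k - E) 0 = 0 := by
    intro k hk
    by_contra hne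
    have hy : 0 < φ k ^ 2 * max (1 / u k - E) 0 :=
      lt_of_le_of_ne (mul_nonneg (sq_nonneg _) (le_max_right _ _)) (Ne.symm hne)
    set y := φ k ^ 2 * max (1 / u k - E) 0
    have hq : 0 ≤ 3 * A k₀ k₀ / y := by positivity
    have h1 := (Finset.single_le_sum (fun i _ => hnn √(3 * A k₀ k₀ / y) i)
      (Finset.mem_univ k)).trans (hbound _)
    rw [agmonWeight, if_pos hk, Real.sq_sqrt hq, mul_right_comm] at h1
    have h2 : y * (3 * A k₀ k₀ / y) = 3 * A k₀ k₀ := by field_simp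
    linarith
  have hterm : ∀ k, ENNReal.ofReal (φ k ^ 2) * eexp (ENNReal.ofReal (2 / √(Wc : ℝ)) * ρ k) *
      ENNReal.ofReal (max (1 / u k - E) 0)
      = ENNReal.ofReal (φ k ^ 2 * agmonWeight Wc 0 (ρ k) ^ 2 * max (1 / u k - E) 0) := by
    intro k
    by_cases hk : ρ k = ⊤
    · rw [mul_right_comm, ← ENNReal.ofReal_mul (sq_nonneg _), htop k hk]
      simp [agmonWeight, hk]
    · rw [eexp_eq_agmonWeight_sq Wc 0 hk, ENNReal.ofReal_mul (by positivity),
        ENNReal.ofReal_mul (sq_nonneg _)]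
  calc _ = ∑ k, ENNReal.ofReal
        (φ k ^ 2 * agmonWeight Wc 0 (ρ k) ^ 2 * max (1 / u k - E) 0) :=
        Finset.sum_congr rfl fun k _ => hterm k
    _ ≤ ENNReal.ofReal ((Wc : ℝ) * |A k₀ k₀|) := by
        rw [← ENNReal.ofReal_sum_of_nonneg fun k _ => hnn 0 k]
        refine ENNReal.ofReal_le_ofReal ((hbound 0).trans ?_)
        rw [abs_of_pos hdiag]
        have : (2 : ℝ) ≤ Wc := by exact_mod_cast hWc
        gcongr
    _ ≤ _ := by
        rw [ENNReal.ofReal_mul (by positivity)]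
        gcongr
        exact le_iSup₂ (f := fun i j => ENNReal.ofReal |A i j|) k₀ k₀
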